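/- arXiv:0911.1966 — 3 statements merged into one kernel-verified Lean document; each statement's English description precedes it below -/
import Mathlib

section
/- Let K be a closed additive subgroup of P = ∏_{l ∈ ℤ} 𝔽₂ such that τ(K) = K. Then K is either finite or equal to all of P. -/
/-- The shift automorphism `τ` of `P = ∏_{l ∈ ℤ} 𝔽₂`, given by `(τ k)(l) = k (l + 1)`. -/
def tauP : AddAut (ℤ → ZMod 2) where
  toFun k l := k (l + 1)
  invFun k l := k (l - 1)
  left_inv k := funext fun l => congrArg k (by ring)
  right_inv k := funext fun l => congrArg k (by ring)
  map_add' _ _ := rfl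

theorem shift_mem_aux (K : AddSubgroup (ℤ → ZMod 2))
    (h : K.map tauP.toAddMonoidHom = K) (k : ℤ → ZMod 2) (hk : k ∈ K) (l : ℤ) :
    (fun j => k (j + l)) ∈ K := by
  induction l using Int.induction_on with
  | zero => simpa using hk
  | succ i ih =>
    rw [← h]
    refine ⟨_, ih, ?_⟩
    funext j
    change k (j + 1 + i) = k (j + (i + 1))
    congr 1; ring
  | pred i ih =>
    rw [← h] at ih
    obtain ⟨y, hy, hye⟩ := ih
    have hy' : y ∈ K := hy
    suffices hs : (fun j => k (j + (-(i : ℤ) - 1))) = y by rw [hs]; exact hy'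
    funext j
    have := congrFun hye (j - 1)
    change y (j - 1 + 1) = k (j - 1 + -i) at this
    rw [sub_add_cancel] at this
    rw [this]
    congr 1; ring

/-- There is a nontrivial linear relation of length `n` satisfied by `K`. -/
def RelAux (K : AddSubgroup (ℤ → ZMod 2)) (n : ℕ) : Prop :=
  ∃ c : ℕ → ZMod 2, (∃ i < n, c i ≠ 0) ∧
    ∀ k ∈ K, ∀ l : ℤ, ∑ i ∈ Finset.range n, c i * k (l + i) = 0

theorem surj_aux (K : AddSubgroup (ℤ → ZMod 2))
    (h : K.map tauP.toAddMonoidHom = K) (n : ℕ) (hn : ¬ RelAux K n) (v : ℕ → ZMod 2) :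
    ∃ k ∈ K, ∀ i < n, k (i : ℤ) = v i := by
  let f : (ℤ → ZMod 2) →ₗ[ZMod 2] (Fin n → ZMod 2) :=
    LinearMap.funLeft (ZMod 2) (ZMod 2) (fun i : Fin n => ((i : ℕ) : ℤ))
  let S : Submodule (ZMod 2) (Fin n → ZMod 2) :=
    (AddSubgroup.toZModSubmodule 2 K).map f
  by_cases hS : S = ⊤
  · have : (fun i : Fin n => v i) ∈ S := hS ▸ Submodule.mem_top
    obtain ⟨k, hk, hke⟩ := this
    exact ⟨k, hk, fun i hi => congrFun hke ⟨i, hi⟩⟩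
  · exfalso
    apply hn
    obtain ⟨g, hg, hgS⟩ := S.exists_le_ker_of_lt_top (lt_top_iff_ne_top.2 hS)
    refine ⟨fun i => if hi : i < n then g (Pi.single ⟨i, hi⟩ 1) else 0, ?_, ?_⟩
    · by_contra hc
      push Not at hc
      apply hg
      apply LinearMap.pi_ext'
      intro i
      ext
      have := hc i i.2
      simpa using this
    · intro k hk l
      have hm : f (fun j => k (j + l)) ∈ S := ⟨_, shift_mem_aux K h k hk l, rfl⟩
      have h0 : g (f (fun j => k (j + l))) = 0 := hgS hm
      rw [LinearMap.pi_apply_eq_sum_univ] at h0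
      rw [Finset.sum_range, ← h0]
      refine Finset.sum_congr rfl fun i _ => ?_
      have e : (Pi.single i 1 : Fin n → ZMod 2) = fun j => if i = j then 1 else 0 := by
        funext j
        simp [Pi.single_apply, eq_comm]
      simp only [i.2, dif_pos, Fin.eta, e, smul_eq_mul]
      rw [mul_comm, add_comm]
      rfl

theorem top_aux (K : AddSubgroup (ℤ → ZMod 2)) (hK : IsClosed (K : Set (ℤ → ZMod 2)))
    (h : K.map tauP.toAddMonoidHom = K) (hn : ∀ n, ¬ RelAux K n) : K = ⊤ := by
  rw [eq_top_iff]
  intro x _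
  change x ∈ (K : Set (ℤ → ZMod 2))
  rw [← hK.closure_eq, mem_closure_iff]
  intro o ho hx
  obtain ⟨I, u, hu, hsub⟩ := isOpen_pi_iff.1 ho x hx
  obtain ⟨N, hN⟩ : ∃ N : ℕ, ∀ i ∈ I, i.natAbs < N :=
    ⟨I.sup Int.natAbs + 1, fun i hi => Nat.lt_succ_of_le (Finset.le_sup (f := Int.natAbs) hi)⟩
  obtain ⟨k, hk, hke⟩ := surj_aux K h (2 * N) (hn _) (fun i => x (i - N))
  refine ⟨_, hsub ?_, shift_mem_aux K h k hk N⟩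
  intro i hi
  have hb := hN i hi
  have := hke (i + N).toNat (by omega)
  have e : (((i + N).toNat : ℕ) : ℤ) = i + N := by omega
  rw [e] at this
  simp only [this, add_sub_cancel_right]
  exact (hu i hi).2

theorem finite_aux (K : AddSubgroup (ℤ → ZMod 2)) (hn : ∃ n, RelAux K n) :
    (K : Set (ℤ → ZMod 2)).Finite := by
  classical
  obtain ⟨n, hn, hmin⟩ : ∃ n, RelAux K n ∧ ∀ m < n, ¬ RelAux K m :=
    ⟨Nat.find hn, Nat.find_spec hn, fun m hm => Nat.find_min hn hm⟩
  obtain ⟨c, ⟨i, hi, hci⟩, hc⟩ := hn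
  obtain ⟨m, rfl⟩ : ∃ m, n = m + 1 := ⟨n - 1, by omega⟩
  have hm := hmin m (by omega)
  have hcm : c m ≠ 0 := by
    intro h0
    refine hm ⟨c, ⟨i, ?_, hci⟩, fun k hk l => ?_⟩
    · rcases Nat.lt_succ_iff_lt_or_eq.1 hi with h1 | h1
      · exact h1
      · exact absurd (h1 ▸ h0) hci
    · have := hc k hk l
      rwa [Finset.sum_range_succ, h0, zero_mul, add_zero] at this
  have hc0 : c 0 ≠ 0 := by
    intro h0
    refine hm ⟨fun j => c (j + 1), ⟨i - 1, ?_, ?_⟩, fun k hk l => ?_⟩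
    · have : i ≠ 0 := by rintro rfl; exact hci h0
      omega
    · have : i ≠ 0 := by rintro rfl; exact hci h0
      simpa [Nat.sub_add_cancel (Nat.pos_of_ne_zero this)] using hci
    · have := hc k hk (l - 1)
      rw [Finset.sum_range_succ', h0, zero_mul, add_zero] at this
      rw [← this]
      refine Finset.sum_congr rfl fun j _ => ?_
      congr 2
      push_cast
      ring
  have key : ∀ k ∈ K, (∀ i < m, k (i : ℤ) = 0) → k = 0 := by
    intro k hk hk0
    have all : ∀ l : ℤ, ∀ i < m, k (l + (i : ℕ)) = 0 := by
      intro l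
      induction l using Int.induction_on with
      | zero => simpa using hk0
      | succ a ih =>
        intro i hi
        by_cases him : i + 1 < m
        · have := ih (i + 1) him
          push_cast at this
          rw [← this]; congr 1; ring
        · have := hc k hk a
          rw [Finset.sum_range_succ, Finset.sum_eq_zero, zero_add] at this
          · have := (mul_eq_zero.1 this).resolve_left hcm
            rw [← this]; congr 1
            have : m = i + 1 := by omega
            subst this; push_cast; ring
          · intro j hj
            rw [ih j (Finset.mem_range.1 hj), mul_zero]
      | pred a ih =>
        intro i hi
        by_cases him : i = 0
        · have := hc k hk (-a - 1)
          rw [Finset.sum_range_succ', Finset.sum_eq_zero, zero_add] at this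
          · have := (mul_eq_zero.1 this).resolve_left hc0
            rw [him]; exact this
          · intro j hj
            have := ih j (Finset.mem_range.1 hj)
            rw [mul_eq_zero]; right
            rw [← this]; congr 1; push_cast; ring
        · have := ih (i - 1) (by omega)
          rw [← this]; congr 1; omega
    have hmm : ∀ l : ℤ, k l = 0 := by
      intro l
      rcases Nat.eq_zero_or_pos m with h0 | h0
      · subst h0
        have := hc k hk l
        simp at this
        exact this.resolve_left hc0
      · simpa using all l 0 h0
    exact funext hmm
  refine Set.Finite.of_finite_image (f := fun k (i : Fin m) => k ((i : ℕ) : ℤ))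
    (Set.toFinite _) ?_
  intro a ha b hb hab
  rw [← sub_eq_zero]
  refine key _ (K.sub_mem ha hb) fun i hi => ?_
  have := congrFun hab ⟨i, hi⟩
  simpa [sub_eq_zero] using this

/-- A closed subgroup of `P = ∏_{l ∈ ℤ} 𝔽₂` (with the product topology, `𝔽₂` discrete)
which is stable under the shift `τ` is finite or all of `P`. -/
theorem finite_or_top_of_closed_shift_stable
    (K : AddSubgroup (ℤ → ZMod 2)) (hK : IsClosed (K : Set (ℤ → ZMod 2)))
    (h : K.map tauP.toAddMonoidHom = K) :
    (K : Set (ℤ → ZMod 2)).Finite ∨ K = ⊤ := by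
  by_cases hn : ∃ n, RelAux K n
  · exact Or.inl (finite_aux K hn)
  · exact Or.inr (top_aux K hK h (not_exists.1 hn))
end

section
/- Let K be a closed additive subgroup of P = ∏_{l ∈ ℤ} 𝔽₂ such that K ⊆ τ(K) and K ≠ τ(K). Then there is an integer J such that K contains the subgroup { k ∈ P : k(j) = 0 for all j < J } (that is, ∏_{j ≥ J} 𝔽₂ is contained in K). -/
/-- The convolution functional attached to a finite set. -/
def cS (S : Finset ℤ) (j : ℤ) (k : ℤ → ZMod 2) : ZMod 2 := ∑ i ∈ S, k (i + j)

theorem cS_add (S : Finset ℤ) (j : ℤ) (k l : ℤ → ZMod 2) :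
    cS S j (k + l) = cS S j k + cS S j l := by
  simp [cS, Finset.sum_add_distrib]

theorem cS_sub (S : Finset ℤ) (j : ℤ) (k l : ℤ → ZMod 2) :
    cS S j (k - l) = cS S j k - cS S j l := by
  simp [cS, Finset.sum_sub_distrib]

theorem cS_shift (S : Finset ℤ) (j m : ℤ) (k : ℤ → ZMod 2) :
    cS S j (fun l => k (l - m)) = cS S (j - m) k := by
  simp only [cS]
  refine Finset.sum_congr rfl fun i _ => congrArg k (by ring)

theorem cS_cont (S : Finset ℤ) (j : ℤ) : Continuous (cS S j) := by
  unfold cS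
  fun_prop

theorem zmod2_cases (x : ZMod 2) : x = 0 ∨ x = 1 := by
  revert x
  decide

/-- separation -/
theorem exists_S (K : AddSubgroup (ℤ → ZMod 2)) (hK : IsClosed (K : Set (ℤ → ZMod 2)))
    (y : ℤ → ZMod 2) (hy : y ∉ K) :
    ∃ S : Finset ℤ, (∀ k ∈ K, cS S 0 k = 0) ∧ cS S 0 y = 1 := by
  classical
  have ho : IsOpen ((K : Set (ℤ → ZMod 2))ᶜ) := hK.isOpen_compl
  rw [isOpen_pi_iff] at ho
  obtain ⟨W, u, hu, hsub⟩ := ho y hy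
  let R : (ℤ → ZMod 2) →ₗ[ZMod 2] (W → ZMod 2) := LinearMap.funLeft (ZMod 2) (ZMod 2) (fun i : W => (i : ℤ))
  let L : Submodule (ZMod 2) (W → ZMod 2) := (AddSubgroup.toZModSubmodule 2 K).map R
  have hyL : R y ∉ L := by
    rintro ⟨z, hz, hzy⟩
    refine hsub (a := z) ?_ hz
    intro i hi
    have : z i = y i := congrFun hzy ⟨i, hi⟩
    rw [this]
    exact (hu i hi).2
  obtain ⟨f, hf, hfL⟩ := Submodule.exists_dual_map_eq_bot_of_notMem hyL inferInstance
  have key : ∀ k, f (R k) = cS ((W.attach.filter (fun i => f (Pi.single i 1) ≠ 0)).map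
      (Function.Embedding.subtype _)) 0 k := by
    intro k
    rw [LinearMap.pi_apply_eq_sum_univ f (R k)]
    simp only [cS, Finset.sum_map, Finset.sum_filter, add_zero]
    rw [Finset.univ_eq_attach]
    refine Finset.sum_congr rfl fun i _ => ?_
    have e : (fun j => if i = j then (1 : ZMod 2) else 0) = Pi.single i 1 := by
      funext j; simp [Pi.single_apply, eq_comm]
    rw [e]
    rcases zmod2_cases (f (Pi.single i 1)) with h | h <;> simp [h, R, LinearMap.funLeft]
  refine ⟨((W.attach.filter (fun i => f (Pi.single i 1) ≠ 0)).map
      (Function.Embedding.subtype _)), fun k hk => ?_, ?_⟩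
  rotate_left
  · rw [← key]
    rcases zmod2_cases (f (R y)) with h | h
    · exact absurd h hf
    · exact h
  · rw [← key]
    have : f (R k) ∈ L.map f := Submodule.mem_map_of_mem (Submodule.mem_map_of_mem hk)
    rw [hfL] at this
    exact (Submodule.mem_bot _).1 this

/-- surjectivity -/
theorem exists_match (K : AddSubgroup (ℤ → ZMod 2)) (hK : IsClosed (K : Set (ℤ → ZMod 2)))
    (hs : ∀ m : ℕ, ∀ k ∈ K, (fun l => k (l - m)) ∈ K) (S : Finset ℤ)
    (h0 : ∀ j ≤ 0, ∀ k ∈ K, cS S j k = 0) (x : ℤ → ZMod 2) (hx : x ∈ K) (hx1 : cS S 1 x = 1)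
    (t : ℤ → ZMod 2) (ht : ∀ j ≤ 0, cS S j t = 0) :
    ∃ k ∈ K, ∀ j, cS S j k = cS S j t := by
  let A : ℕ → Set (ℤ → ZMod 2) := fun m => {k | k ∈ K ∧ ∀ j ≤ (m : ℤ), cS S j k = cS S j t}
  have hA : ∀ m, IsClosed (A m) := by
    intro m
    have : A m = (K : Set _) ∩ ⋂ j : ℤ, ⋂ _ : j ≤ (m : ℤ), {k | cS S j k = cS S j t} := by
      ext k; simp [A]
    rw [this]
    refine hK.inter (isClosed_iInter fun j => isClosed_iInter fun _ => ?_)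
    exact isClosed_eq (cS_cont S j) continuous_const
  have hn : ∀ m, (A m).Nonempty := by
    intro m
    induction m with
    | zero => exact ⟨0, K.zero_mem, fun j hj => by
        rw [h0 j (by simpa using hj) 0 K.zero_mem, ht j (by simpa using hj)]⟩
    | succ m ih =>
      obtain ⟨z, hz, hzt⟩ := ih
      by_cases h : cS S (m + 1) z = cS S (m + 1) t
      · refine ⟨z, hz, fun j hj => ?_⟩
        push_cast at hj
        rcases hj.lt_or_eq with h' | rfl
        · exact hzt j (by omega)
        · exact h
      · refine ⟨z + fun l => x (l - m), K.add_mem hz (hs m x hx), fun j hj => ?_⟩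
        rw [cS_add, cS_shift]
        push_cast at hj
        rcases hj.lt_or_eq with h' | rfl
        · rw [h0 (j - m) (by omega) x hx, hzt j (by omega), add_zero]
        · rw [show (m : ℤ) + 1 - m = 1 by ring, hx1]
          rcases zmod2_cases (cS S (m + 1) z) with h1 | h1 <;>
          rcases zmod2_cases (cS S (m + 1) t) with h2 | h2 <;> rw [h1, h2] at h ⊢ <;> revert h <;> decide
  obtain ⟨k, hk⟩ := IsCompact.nonempty_iInter_of_sequence_nonempty_isCompact_isClosed A
    (fun m k hk => ⟨hk.1, fun j hj => hk.2 j (by push_cast; omega)⟩) hn (hA 0).isCompact hA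
  rw [Set.mem_iInter] at hk
  exact ⟨k, (hk 0).1, fun j => (hk j.toNat).2 j (by omega)⟩

/-- rigidity of the kernel -/
theorem ker_rigid (S : Finset ℤ) (hS : S.Nonempty) (k : ℤ → ZMod 2) (hk : ∀ j, cS S j k = 0)
    (h : ∀ i, S.min' hS ≤ i → i < S.max' hS → k i = 0) : k = 0 := by
  have hle : S.min' hS ≤ S.max' hS := S.min'_le_max' hS
  have main : ∀ m : ℕ, ∀ i, S.min' hS - m ≤ i → i < S.max' hS + m → k i = 0 := by
    intro m
    induction m with
    | zero => intro i h1 h2; exact h i (by simpa using h1) (by simpa using h2)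
    | succ m ih =>
      intro i h1 h2
      push_cast at h1 h2
      by_cases hi1 : i < S.min' hS - m
      · have := hk (i - S.min' hS)
        rw [cS, Finset.sum_eq_single (S.min' hS)] at this
        · simpa using this
        · intro b hb hne
          have b1 := S.min'_le b hb
          have b2 := S.le_max' b hb
          exact ih _ (by omega) (by omega)
        · exact fun h => absurd (S.min'_mem hS) h
      by_cases hi2 : S.max' hS + m ≤ i
      · have := hk (i - S.max' hS)
        rw [cS, Finset.sum_eq_single (S.max' hS)] at this
        · simpa using this
        · intro b hb hne
          have b1 := S.min'_le b hb
          have b2 := S.le_max' b hb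
          exact ih _ (by omega) (by omega)
        · exact fun h => absurd (S.max'_mem hS) h
      exact ih i (by omega) (by omega)
  funext i
  exact main (i.natAbs + (S.min' hS).natAbs + (S.max' hS).natAbs + 1) i (by omega) (by omega)

/-- extension by zero from `[J, ∞)` -/
def extJ (J : ℤ) : (ℕ → ZMod 2) →+ (ℤ → ZMod 2) where
  toFun a l := if l < J then 0 else a (l - J).toNat
  map_zero' := by ext; simp
  map_add' a b := by ext l; by_cases h : l < J <;> simp [h]

theorem extJ_cont (J : ℤ) : Continuous (extJ J) := by
  refine continuous_pi fun l => ?_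
  by_cases h : l < J
  · simpa [extJ, h] using continuous_const
  · simpa [extJ, h] using continuous_apply _

theorem tail_subgroup_le_of_closed_strictly_expanding
    (K : AddSubgroup (ℤ → ZMod 2)) (hK : IsClosed (K : Set (ℤ → ZMod 2)))
    (hle : K ≤ K.map tauP.toAddMonoidHom) (hne : K ≠ K.map tauP.toAddMonoidHom) :
    ∃ J : ℤ, ∀ k : ℤ → ZMod 2, (∀ j : ℤ, j < J → k j = 0) → k ∈ K := by
  have hs1 : ∀ k ∈ K, (fun l => k (l - 1)) ∈ K := by
    intro k hk
    obtain ⟨z, hz, rfl⟩ := hle hk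
    have e : (fun l => tauP.toAddMonoidHom z (l - 1)) = z := by
      funext l
      change z (l - 1 + 1) = z l
      exact congrArg z (by ring)
    rw [e]
    exact hz
  have hs : ∀ m : ℕ, ∀ k ∈ K, (fun l => k (l - m)) ∈ K := by
    intro m
    induction m with
    | zero => intro k hk; simpa using hk
    | succ m ih =>
      intro k hk
      convert hs1 _ (ih k hk) using 1
      funext l
      exact congrArg k (by push_cast; ring)
  have hex : ∃ x ∈ K, (fun l => x (l + 1)) ∉ K := by
    by_contra! hcon
    refine hne (le_antisymm hle ?_)
    rintro _ ⟨x, hx, rfl⟩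
    exact hcon x hx
  obtain ⟨x, hx, hxy⟩ := hex
  obtain ⟨S, hS0, hS1⟩ := exists_S K hK _ hxy
  have hSne : S.Nonempty := by
    rw [Finset.nonempty_iff_ne_empty]
    rintro rfl
    simp [cS] at hS1
  have hx1 : cS S 1 x = 1 := by
    rw [← hS1]; simp [cS]
  have h0 : ∀ j ≤ 0, ∀ k ∈ K, cS S j k = 0 := by
    intro j hj k hk
    have := hS0 _ (hs (-j).toNat k hk)
    rw [cS_shift] at this
    rwa [show (0 : ℤ) - ((-j).toNat : ℤ) = j by omega] at this
  set J : ℤ := S.max' hSne + 1 with hJ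
  have hT : ∀ a : ℕ → ZMod 2, ∃ k ∈ K, ∀ j, cS S j k = cS S j (extJ J a) := by
    intro a
    refine exists_match K hK hs S h0 x hx hx1 _ fun j hj => ?_
    refine Finset.sum_eq_zero fun i hi => ?_
    have := S.le_max' i hi
    simp only [extJ, AddMonoidHom.coe_mk, ZeroHom.coe_mk]
    rw [if_pos (by omega)]
  choose g hgK hg using hT
  let H : AddSubgroup (ℕ → ZMod 2) := K.comap (extJ J)
  have hHc : IsClosed (H : Set (ℕ → ZMod 2)) := hK.preimage (extJ_cont J)
  let r : (ℕ → ZMod 2) → (Finset.Ico (S.min' hSne) (S.max' hSne) → ZMod 2) :=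
    fun a i => (extJ J a - g a) i
  have hr : ∀ a b, r a = r b → a - b ∈ H := by
    intro a b hab
    have hz : (extJ J a - g a) - (extJ J b - g b) = 0 := by
      apply ker_rigid S hSne
      · intro j; rw [cS_sub, cS_sub, cS_sub, hg, hg]; simp
      · intro i h1 h2
        have := congrFun hab ⟨i, Finset.mem_Ico.2 ⟨h1, h2⟩⟩
        exact sub_eq_zero.2 this
    change extJ J (a - b) ∈ K
    have : extJ J (a - b) = g a - g b := by
      rw [map_sub, ← sub_eq_zero, ← hz]; abel
    rw [this]
    exact K.sub_mem (hgK a) (hgK b)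
  have hfin : Finite ((ℕ → ZMod 2) ⧸ H) := by
    refine Finite.of_injective (fun q : (ℕ → ZMod 2) ⧸ H => r q.out) fun p q hpq => ?_
    have := hr _ _ hpq
    rw [← QuotientAddGroup.out_eq' p, ← QuotientAddGroup.out_eq' q, eq_comm, QuotientAddGroup.eq]
    rwa [neg_add_eq_sub]
  have hfi : H.FiniteIndex := AddSubgroup.finiteIndex_of_finite_quotient
  have hHo : IsOpen (H : Set (ℕ → ZMod 2)) := H.isOpen_of_isClosed_of_finiteIndex hHc
  rw [isOpen_pi_iff] at hHo
  obtain ⟨I, u, hu, hsub⟩ := hHo 0 H.zero_mem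
  refine ⟨J + (I.sup id : ℕ) + 1, fun k hk => ?_⟩
  have hmem : (fun n : ℕ => k (J + n)) ∈ H := by
    apply hsub
    intro i hi
    have : i ≤ I.sup id := Finset.le_sup (f := id) hi
    simp only
    rw [hk _ (by omega)]
    exact (hu i hi).2
  have : extJ J (fun n : ℕ => k (J + n)) = k := by
    funext l
    simp only [extJ, AddMonoidHom.coe_mk, ZeroHom.coe_mk]
    split_ifs with h
    · exact (hk l (by omega)).symm
    · exact congrArg k (by omega)
  rw [← this]
  exact hmem
end

section
/- Let C be a group and B a subgroup of C of finite index. Suppose that the intersection ⋂_{α ∈ Aut(C)} α(B), taken over all group automorphisms α of C, has infinite index in C. Then there exist a finite index subgroup E ≤ C and a finite simple group F (possibly abelian) such that for every natural number n there is a surjective group homomorphism from E onto Fⁿ (the direct product of n copies of F). -/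
universe u

/-- `F` is a target for quotients of `E` onto all of its finite powers: `F` is a finite
simple group and for every `n` there is a surjection `E ↠ Fⁿ`. -/
def SurjectsOntoAllPowers (E : Type*) [Group E] (F : Type*) [Group F] : Prop :=
  Finite F ∧ IsSimpleGroup F ∧ ∀ n : ℕ, ∃ g : E →* (Fin n → F), Function.Surjective g


theorem exists_simple_quotient_aux (k : ℕ) : ∀ (Q : Type u) [Group Q] [Finite Q] [Nontrivial Q],
    Nat.card Q = k → ∃ (F : Type u) (_ : Group F), Finite F ∧ IsSimpleGroup F ∧
      ∃ p : Q →* F, Function.Surjective p := by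
  induction k using Nat.strong_induction_on with
  | _ k ih =>
    intro Q _ _ _ hk
    by_cases hs : IsSimpleGroup Q
    · exact ⟨Q, inferInstance, inferInstance, hs, MonoidHom.id Q, Function.surjective_id⟩
    · have : ∃ N : Subgroup Q, N.Normal ∧ N ≠ ⊥ ∧ N ≠ ⊤ := by
        by_contra! hcon
        apply hs
        refine ⟨fun N hN => ?_⟩
        by_cases hb : N = ⊥
        · exact Or.inl hb
        · exact Or.inr (hcon N hN hb)
      obtain ⟨N, hN, hb, ht⟩ := this
      have hnt : Nontrivial (Q ⧸ N) := QuotientGroup.nontrivial_iff.mpr ht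
      have hlt : Nat.card (Q ⧸ N) < k := by
        have h1 := N.card_eq_card_quotient_mul_card_subgroup
        have h2 : 1 < Nat.card N := N.one_lt_card_iff_ne_bot.mpr hb
        have h3 : 0 < Nat.card (Q ⧸ N) := Nat.card_pos
        rw [hk] at h1
        nlinarith
      obtain ⟨F, iF, hF, hsF, p, hp⟩ := ih _ hlt (Q ⧸ N) rfl
      exact ⟨F, iF, hF, hsF, p.comp (QuotientGroup.mk' N),
        hp.comp (QuotientGroup.mk'_surjective N)⟩

theorem powers_surj_aux {D Q : Type u} [Group D] [Group Q] [Finite Q] {ι : Type u}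
    (f : ι → D →* Q)
    (h : ∀ E : Subgroup D, E.index ≠ 0 → ∃ i, ∀ q, ∃ e ∈ E, f i e = q) (n : ℕ) :
    ∃ g : D →* (Fin n → Q), Function.Surjective g := by
  induction n with
  | zero => exact ⟨1, fun x => ⟨1, Subsingleton.elim _ _⟩⟩
  | succ n ih =>
    obtain ⟨g, hg⟩ := ih
    have hfin : g.ker.index ≠ 0 := by
      rw [Subgroup.index_ker]
      exact Nat.card_pos.ne'
    obtain ⟨i, hi⟩ := h g.ker hfin
    refine ⟨MonoidHom.mk' (fun d => Fin.cons (f i d) (g d)) ?_, ?_⟩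
    · intro a b
      funext j
      refine Fin.cases ?_ (fun j => ?_) j <;> simp
    · intro x
      obtain ⟨d, hd⟩ := hg (Fin.tail x)
      obtain ⟨e, he, hq⟩ := hi (x 0 * (f i d)⁻¹)
      refine ⟨e * d, ?_⟩
      have he' : g e = 1 := he
      funext j
      refine Fin.cases ?_ (fun j => ?_) j
      · simp [hq]
      · simp [he', hd, Fin.tail]

theorem family_aux (k : ℕ) : ∀ (D Q ι : Type u) [Group D] [Group Q] [Finite Q]
    (f : ι → D →* Q), Nat.card Q = k → (⨅ i, (f i).ker).index = 0 →
    ∃ E : Subgroup D, E.index ≠ 0 ∧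
      ∃ (F : Type u) (instF : Group F), @SurjectsOntoAllPowers ↥E _ F instF := by
  induction k using Nat.strong_induction_on with
  | _ k ih =>
    intro D Q ι _ _ _ f hk hinf
    by_cases h : ∀ E : Subgroup D, E.index ≠ 0 → ∃ i, ∀ q, ∃ e ∈ E, f i e = q
    · have hnt : Nontrivial Q := by
        by_contra hcon
        rw [not_nontrivial_iff_subsingleton] at hcon
        have : (⨅ i, (f i).ker) = ⊤ := by
          rw [iInf_eq_top]
          intro i
          ext x
          simp [MonoidHom.mem_ker, Subsingleton.elim (f i x) 1]
        rw [this] at hinf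
        simp at hinf
      obtain ⟨F, iF, hF, hsF, p, hp⟩ := exists_simple_quotient_aux _ Q rfl
      refine ⟨⊤, by simp, F, iF, hF, hsF, fun n => ?_⟩
      have h' : ∀ E : Subgroup D, E.index ≠ 0 → ∃ i, ∀ q, ∃ e ∈ E, (p.comp (f i)) e = q := by
        intro E hE
        obtain ⟨i, hi⟩ := h E hE
        refine ⟨i, fun q => ?_⟩
        obtain ⟨y, rfl⟩ := hp q
        obtain ⟨e, he, rfl⟩ := hi y
        exact ⟨e, he, rfl⟩
      obtain ⟨g, hg⟩ := powers_surj_aux (fun i => p.comp (f i)) h' n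
      refine ⟨g.comp (⊤ : Subgroup D).subtype, fun x => ?_⟩
      obtain ⟨d, rfl⟩ := hg x
      exact ⟨⟨d, trivial⟩, rfl⟩
    · push Not at h
      obtain ⟨E, hE, hprop⟩ := h
      have key : ∃ H : Subgroup Q, H ≠ ⊤ ∧
          (⨅ i : {i : ι // ((f i).comp E.subtype).range = H},
            ((f i.1).comp E.subtype).ker).index = 0 := by
        by_contra! hcon
        have hne : ∀ H : Subgroup Q,
          (⨅ i : {i : ι // ((f i).comp E.subtype).range = H},
            ((f i.1).comp E.subtype).ker).index ≠ 0 := by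
          intro H
          by_cases hH : H = ⊤
          · have : IsEmpty {i : ι // ((f i).comp E.subtype).range = H} := by
              refine ⟨fun ⟨i, hi⟩ => ?_⟩
              obtain ⟨q, hq⟩ := hprop i
              have : q ∈ ((f i).comp E.subtype).range := by rw [hi, hH]; trivial
              obtain ⟨e, he⟩ := this
              exact hq e e.2 he
            rw [iInf_of_empty]
            simp
          · exact hcon H hH
        have h1 := Subgroup.index_iInf_ne_zero hne
        have hle : (⨅ H : Subgroup Q, ⨅ i : {i : ι // ((f i).comp E.subtype).range = H},
            ((f i.1).comp E.subtype).ker) ≤ (⨅ i, (f i).ker).subgroupOf E := by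
          intro x hx
          rw [Subgroup.mem_subgroupOf, Subgroup.mem_iInf]
          intro i
          have h2 := Subgroup.mem_iInf.mp (Subgroup.mem_iInf.mp hx _) ⟨i, rfl⟩
          exact h2
        have h3 : (⨅ i, (f i).ker).relIndex E ≠ 0 := fun h0 =>
          h1 (Nat.eq_zero_of_zero_dvd (h0 ▸ Subgroup.index_dvd_of_le hle))
        have h4 : (⨅ i, (f i).ker) ⊓ E ≤ (⨅ i, (f i).ker) := inf_le_left
        have h5 := Subgroup.index_dvd_of_le h4
        rw [hinf] at h5
        have h6 := Subgroup.relIndex_mul_index (inf_le_right : (⨅ i, (f i).ker) ⊓ E ≤ E)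
        rw [Subgroup.inf_relIndex_right] at h6
        have h7 : ((⨅ i, (f i).ker) ⊓ E).index ≠ 0 := h6 ▸ mul_ne_zero h3 hE
        exact h7 (Nat.eq_zero_of_zero_dvd h5)
      obtain ⟨H, hH, hHinf⟩ := key
      have hlt : Nat.card H < k := by
        rw [← hk]
        exact lt_of_le_of_ne (Subgroup.card_le_card_group H)
          (fun he => hH (Subgroup.eq_top_of_card_eq H he))
      let f' : {i : ι // ((f i).comp E.subtype).range = H} → E →* H := fun i =>
        ((f i.1).comp E.subtype).codRestrict H (fun x => by
          have : ((f i.1).comp E.subtype) x ∈ ((f i.1).comp E.subtype).range := ⟨x, rfl⟩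
          rwa [i.2] at this)
      have hf' : (⨅ i, (f' i).ker).index = 0 := by
        have : ∀ i, (f' i).ker = ((f i.1).comp E.subtype).ker := fun i =>
          MonoidHom.ker_codRestrict _ _ _
        simp_rw [this]
        exact hHinf
      obtain ⟨E', hE', F, iF, hF, hsF, hpow⟩ := ih _ hlt E H _ f' rfl hf'
      refine ⟨E'.map E.subtype, ?_, F, iF, hF, hsF, fun n => ?_⟩
      · rw [Subgroup.index_map_subtype]
        exact mul_ne_zero hE' hE
      · obtain ⟨g, hg⟩ := hpow n
        let e := E'.equivMapOfInjective E.subtype E.subtype_injective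
        exact ⟨g.comp e.symm.toMonoidHom, hg.comp e.symm.surjective⟩

theorem exists_finite_simple_powers_quotient_of_infinite_core {C : Type u} [Group C]
    (B : Subgroup C) (hB : B.index ≠ 0)
    (hcore : (⨅ α : MulAut C, B.map α.toMonoidHom).index = 0) :
    ∃ E : Subgroup C, E.index ≠ 0 ∧
      ∃ (F : Type u) (instF : Group F), @SurjectsOntoAllPowers ↥E _ F instF := by
  have hN : B.normalCore.index ≠ 0 := by
    have : B.FiniteIndex := ⟨hB⟩
    exact Subgroup.FiniteIndex.index_ne_zero
  have : B.normalCore.FiniteIndex := ⟨hN⟩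
  haveI : Finite (C ⧸ B.normalCore) := Subgroup.finite_quotient_of_finiteIndex
  refine family_aux _ C (C ⧸ B.normalCore) (MulAut C)
    (fun α => (QuotientGroup.mk' B.normalCore).comp α.symm.toMonoidHom) rfl ?_
  have hle : (⨅ α : MulAut C,
      ((QuotientGroup.mk' B.normalCore).comp α.symm.toMonoidHom).ker) ≤
      ⨅ α : MulAut C, B.map α.toMonoidHom := by
    refine iInf_mono fun α x hx => ?_
    have h1 : α.symm x ∈ B.normalCore := (QuotientGroup.eq_one_iff _).mp hx
    exact ⟨α.symm x, B.normalCore_le h1, α.apply_symm_apply x⟩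
  have := Subgroup.index_dvd_of_le hle
  rw [hcore] at this
  exact Nat.eq_zero_of_zero_dvd this
end
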